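/- arXiv:2508.12836 — 2 statements merged into one kernel-verified Lean document; each statement's English description precedes it below -/
import Mathlib

section
/- Let C be a Krull-Schmidt triangulated category with a Serre functor ν, d ≥ 1 an integer, and suppose C has a d-cluster tilting subcategory admitting an additive generator. Then every d-cluster tilting subcategory of C has an additive generator. The analogous statement holds with 'additive generator' replaced by 'ν_d-additive generator', where ν_d = ν ∘ [−d]. -/
/-!
STATEMENT 4: In a k-linear Hom-finite Krull-Schmidt triangulated category C with
Serre functor ν, if some d-cluster tilting subcategory has an additive generator
(resp. a ν_d-additive generator) then every d-cluster tilting subcategory has one.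
-/

open CategoryTheory CategoryTheory.Limits CategoryTheory.Pretriangulated

universe w v u

variable (k : Type w) [Field k]
variable (C : Type u) [Category.{v} C] [Preadditive C] [Linear k C] [HasZeroObject C]
  [HasShift C ℤ] [∀ n : ℤ, (CategoryTheory.shiftFunctor C n).Additive] [Pretriangulated C]
  [HasBinaryBiproducts C]

/-- The extension subcategory `X * Y`. -/
def starSet (X Y : Set C) : Set C :=
  {T | ∃ A ∈ X, ∃ B ∈ Y, ∃ (f : A ⟶ T) (g : T ⟶ B) (h : B ⟶ A⟦(1:ℤ)⟧),
    Triangle.mk f g h ∈ distTriang C}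

/-- The shift `S[n]` of a subcategory. -/
def shiftSet (S : Set C) (n : ℤ) : Set C := {X | ∃ A ∈ S, Nonempty (X ≅ A⟦n⟧)}

/-- Iterated extension subcategory. -/
def starList : List (Set C) → Set C
  | [] => {T | IsZero T}
  | [S] => S
  | S :: T :: rest => starSet C S (starList (T :: rest))

/-- Objects obtained as finite direct sums of objects of `S`. -/
inductive sums (S : Set C) : C → Prop
  | of {X : C} : X ∈ S → sums S X
  | biprod {X Y : C} : sums S X → sums S Y → sums S (X ⊞ Y)

/-- The additive closure `add S`: direct summands of finite direct sums of objects of `S`. -/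
def addSet (S : Set C) : Set C :=
  {X | ∃ Y Z : C, sums C S Y ∧ Nonempty (Y ≅ X ⊞ Z)}

/-- Iteration of an endofunctor. -/
def iterObj (F : C ⥤ C) : ℕ → C → C
  | 0, X => X
  | n + 1, X => F.obj (iterObj F n X)

/-- A Serre functor on a k-linear category: an (additive) autoequivalence ν together
with functorial isomorphisms D Hom(X,Y) ≅ Hom(Y, νX). -/
structure SerreFunctor : Type (max (max u v) w) where
  ν : C ≌ C
  additive : ν.functor.Additive
  duality : ∀ X Y : C, (Y ⟶ ν.functor.obj X) ≃ₗ[k] Module.Dual k (X ⟶ Y)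
  natural : ∀ (X Y X' Y' : C) (a : X ⟶ X') (b : Y' ⟶ Y) (f : Y ⟶ ν.functor.obj X),
    duality X' Y' (b ≫ f ≫ ν.functor.map a) = fun g => duality X Y f (a ≫ g ≫ b)

variable {k C}

/-- ν_d = ν ∘ [-d]. -/
def nud (S : SerreFunctor k C) (d : ℕ) : C ⥤ C :=
  CategoryTheory.shiftFunctor C (-(d : ℤ)) ⋙ S.ν.functor

/-- The inverse of ν_d. -/
def nudInv (S : SerreFunctor k C) (d : ℕ) : C ⥤ C :=
  S.ν.inverse ⋙ CategoryTheory.shiftFunctor C (d : ℤ)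

/-- The ν_d-orbit of an object (closed under isomorphism). -/
def nudOrbit (S : SerreFunctor k C) (d : ℕ) (X : C) : Set C :=
  {Y | ∃ n : ℕ, Nonempty (Y ≅ iterObj C (nud S d) n X) ∨
    Nonempty (Y ≅ iterObj C (nudInv S d) n X)}

/-- `U` is a d-cluster tilting subcategory: closed under summands, d-rigid,
functorially finite, equal to both perpendicular subcategories, and
C = U * U[1] * ... * U[d]. -/
structure IsDCT (d : ℕ) (U : Set C) : Prop where
  add_closed : addSet C U = U
  rigid : ∀ A ∈ U, ∀ B ∈ U, ∀ i : ℤ, 1 ≤ i → i ≤ (d : ℤ) - 1 → ∀ f : A ⟶ B⟦i⟧, f = 0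
  contra : ∀ X : C, ∃ A ∈ U, ∃ f : A ⟶ X, ∀ B ∈ U, ∀ g : B ⟶ X, ∃ h : B ⟶ A, h ≫ f = g
  cova : ∀ X : C, ∃ A ∈ U, ∃ f : X ⟶ A, ∀ B ∈ U, ∀ g : X ⟶ B, ∃ h : A ⟶ B, f ≫ h = g
  perp_left : ∀ X : C,
    (∀ A ∈ U, ∀ i : ℤ, 1 ≤ i → i ≤ (d : ℤ) - 1 → ∀ f : A ⟶ X⟦i⟧, f = 0) → X ∈ U
  perp_right : ∀ X : C,
    (∀ A ∈ U, ∀ i : ℤ, 1 ≤ i → i ≤ (d : ℤ) - 1 → ∀ f : X ⟶ A⟦i⟧, f = 0) → X ∈ U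
  gen : ∀ T : C, T ∈ starList C ((List.range (d + 1)).map fun i => shiftSet C U (i : ℤ))

/-- `U` has an additive generator. -/
def HasAddGen (U : Set C) : Prop := ∃ G ∈ U, U = addSet C {G}

/-- `U` has a ν_d-additive generator. -/
def HasNudGen (S : SerreFunctor k C) (d : ℕ) (U : Set C) : Prop :=
  ∃ G ∈ U, U = addSet C (nudOrbit S d G)

set_option linter.unusedSectionVars false
set_option linter.style.haveILetI false

lemma dt_y3 {X Y Z W : C} {f : X ⟶ Y} {g : Y ⟶ Z} {h : Z ⟶ X⟦(1:ℤ)⟧}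
    (hT : Triangle.mk f g h ∈ distTriang C) (x : Z ⟶ W) (hx : g ≫ x = 0) :
    ∃ y : X⟦(1:ℤ)⟧ ⟶ W, x = h ≫ y := Triangle.yoneda_exact₃ _ hT x hx

lemma dt_y4 {X Y Z W : C} {f : X ⟶ Y} {g : Y ⟶ Z} {h : Z ⟶ X⟦(1:ℤ)⟧}
    (hT : Triangle.mk f g h ∈ distTriang C) (x : X⟦(1:ℤ)⟧ ⟶ W) (hx : h ≫ x = 0) :
    ∃ y : Y⟦(1:ℤ)⟧ ⟶ W, x = (-f⟦(1:ℤ)⟧') ≫ y :=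
  Triangle.yoneda_exact₃ _ (rot_of_distTriang _ hT) x hx

lemma dt_c1 {X Y Z W : C} {f : X ⟶ Y} {g : Y ⟶ Z} {h : Z ⟶ X⟦(1:ℤ)⟧}
    (hT : Triangle.mk f g h ∈ distTriang C) (x : W ⟶ X⟦(1:ℤ)⟧) (hx : x ≫ f⟦(1:ℤ)⟧' = 0) :
    ∃ y : W ⟶ Z, x = y ≫ h := Triangle.coyoneda_exact₁ _ hT x hx

lemma dt_c3 {X Y Z W : C} {f : X ⟶ Y} {g : Y ⟶ Z} {h : Z ⟶ X⟦(1:ℤ)⟧}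
    (hT : Triangle.mk f g h ∈ distTriang C) (x : W ⟶ Z) (hx : x ≫ h = 0) :
    ∃ y : W ⟶ Y, x = y ≫ g := Triangle.coyoneda_exact₃ _ hT x hx

lemma dt_z31 {X Y Z : C} {f : X ⟶ Y} {g : Y ⟶ Z} {h : Z ⟶ X⟦(1:ℤ)⟧}
    (hT : Triangle.mk f g h ∈ distTriang C) : h ≫ f⟦(1:ℤ)⟧' = 0 :=
  comp_distTriang_mor_zero₃₁ _ hT

lemma dt_z23 {X Y Z : C} {f : X ⟶ Y} {g : Y ⟶ Z} {h : Z ⟶ X⟦(1:ℤ)⟧}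
    (hT : Triangle.mk f g h ∈ distTriang C) : g ≫ h = 0 :=
  comp_distTriang_mor_zero₂₃ _ hT

lemma dt_hom {X Y Z X' Y' Z' : C} {f : X ⟶ Y} {g : Y ⟶ Z} {h : Z ⟶ X⟦(1:ℤ)⟧}
    {f' : X' ⟶ Y'} {g' : Y' ⟶ Z'} {h' : Z' ⟶ X'⟦(1:ℤ)⟧}
    (hT : Triangle.mk f g h ∈ distTriang C) (hT' : Triangle.mk f' g' h' ∈ distTriang C)
    (a : X ⟶ X') (b : Y ⟶ Y') (hab : f ≫ b = a ≫ f') :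
    ∃ c : Z ⟶ Z', g ≫ c = b ≫ g' ∧ h ≫ a⟦(1:ℤ)⟧' = c ≫ h' :=
  complete_distinguished_triangle_morphism _ _ hT hT' a b hab

/-- All morphisms `X ⟶ Y` vanish. -/
def Hz (X Y : C) : Prop := ∀ f : X ⟶ Y, f = 0

lemma Hz.iso_left {X X' Y : C} (e : X ≅ X') (h : Hz X Y) : Hz X' Y := fun f => by
  have := h (e.hom ≫ f)
  simpa using congrArg (fun t => e.inv ≫ t) this

lemma Hz.iso_right {X Y Y' : C} (e : Y ≅ Y') (h : Hz X Y) : Hz X Y' := fun f => by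
  have := h (f ≫ e.inv)
  simpa using congrArg (fun t => t ≫ e.hom) this

lemma Hz.of_functor {X Y : C} (F : C ⥤ C) [F.Faithful] [F.Additive]
    (h : Hz (F.obj X) (F.obj Y)) : Hz X Y := fun f =>
  F.map_injective (by rw [h (F.map f), F.map_zero])

lemma Hz.functor {X Y : C} (F : C ⥤ C) [F.Full] [F.Additive]
    (h : Hz X Y) : Hz (F.obj X) (F.obj Y) := fun f => by
  obtain ⟨g, rfl⟩ := F.map_surjective f
  rw [h g, F.map_zero]

lemma Hz.shift_iff (X Y : C) (a b c : ℤ) (h : c + a = b) :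
    Hz (X⟦a⟧) (Y⟦b⟧) ↔ Hz X (Y⟦c⟧) := by
  let e : Y⟦b⟧ ≅ Y⟦c⟧⟦a⟧ := (shiftFunctorAdd' C c a b h).app Y
  constructor
  · intro H
    exact Hz.of_functor (shiftFunctor C a) (H.iso_right e)
  · intro H
    exact (Hz.functor (shiftFunctor C a) H).iso_right e.symm

lemma Hz.shift_left_iff (X Y : C) (a c : ℤ) (h : c + a = 0) :
    Hz (X⟦a⟧) Y ↔ Hz X (Y⟦c⟧) := by
  rw [← Hz.shift_iff X Y a 0 c h]
  let e : Y⟦(0:ℤ)⟧ ≅ Y := (shiftFunctorZero C ℤ).app Y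
  exact ⟨fun H => H.iso_right e.symm, fun H => H.iso_right e⟩

lemma Hz.shift_shift_iff (X Y : C) (a b c : ℤ) (h : a + b = c) :
    Hz X (Y⟦a⟧⟦b⟧) ↔ Hz X (Y⟦c⟧) := by
  let e : Y⟦c⟧ ≅ Y⟦a⟧⟦b⟧ := (shiftFunctorAdd' C a b c h).app Y
  exact ⟨fun H => H.iso_right e.symm, fun H => H.iso_right e⟩

/-- Exactness in the second variable, after a shift. -/
lemma Hz.mid_right {T : Triangle C} (hT : T ∈ distTriang C) (X : C) (s : ℤ)
    (h1 : Hz X (T.obj₁⟦s⟧)) (h3 : Hz X (T.obj₃⟦s⟧)) : Hz X (T.obj₂⟦s⟧) := by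
  rw [← Hz.shift_left_iff X _ (-s) s (by omega)] at *
  intro f
  obtain ⟨g, rfl⟩ := Triangle.coyoneda_exact₂ T hT f (h3 _)
  rw [h1 g, zero_comp]

/-- The ideal of morphisms factoring through `add A`. -/
def Idl (A X Y : C) : AddSubgroup (X ⟶ Y) :=
  AddSubgroup.closure {f | ∃ (a : X ⟶ A) (b : A ⟶ Y), f = a ≫ b}

lemma Idl.base {A X Y : C} (a : X ⟶ A) (b : A ⟶ Y) : a ≫ b ∈ Idl A X Y :=
  AddSubgroup.subset_closure ⟨a, b, rfl⟩

lemma Idl.id (A : C) : 𝟙 A ∈ Idl A A A := by simpa using Idl.base (𝟙 A) (𝟙 A)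

/-- Induction principle for the ideal with an additive target. -/
lemma Idl.ind {A X Y : C} {f : X ⟶ Y} (hf : f ∈ Idl A X Y) (P : AddSubgroup (X ⟶ Y))
    (h : ∀ (a : X ⟶ A) (b : A ⟶ Y), a ≫ b ∈ P) : f ∈ P := by
  have : Idl A X Y ≤ P := (AddSubgroup.closure_le _).2 (by rintro _ ⟨a, b, rfl⟩; exact h a b)
  exact this hf

lemma Idl.comp_left {A X' X Y : C} (g : X' ⟶ X) {f : X ⟶ Y} (hf : f ∈ Idl A X Y) :
    g ≫ f ∈ Idl A X' Y :=
  Idl.ind hf ((Idl A X' Y).comap (Preadditive.leftComp Y g)) (fun a b => by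
    change g ≫ a ≫ b ∈ Idl A X' Y
    rw [← Category.assoc]; exact Idl.base _ _)

lemma Idl.comp_right {A X Y Y' : C} {f : X ⟶ Y} (hf : f ∈ Idl A X Y) (g : Y ⟶ Y') :
    f ≫ g ∈ Idl A X Y' :=
  Idl.ind hf ((Idl A X Y').comap (Preadditive.rightComp X g)) (fun a b => by
    change (a ≫ b) ≫ g ∈ Idl A X Y'
    rw [Category.assoc]; exact Idl.base _ _)

lemma Idl.trans {A A' X Y : C} (hA : 𝟙 A ∈ Idl A' A A) {f : X ⟶ Y} (hf : f ∈ Idl A X Y) :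
    f ∈ Idl A' X Y :=
  Idl.ind hf _ (fun a b => by
    have := Idl.comp_left a (Idl.comp_right hA b)
    simpa using this)

lemma Idl.map {A X Y : C} {f : X ⟶ Y} (hf : f ∈ Idl A X Y) (F : C ⥤ C) [F.Additive] :
    F.map f ∈ Idl (F.obj A) (F.obj X) (F.obj Y) :=
  Idl.ind hf ((Idl (F.obj A) (F.obj X) (F.obj Y)).comap F.mapAddHom) (fun a b => by
    change F.map (a ≫ b) ∈ Idl (F.obj A) (F.obj X) (F.obj Y)
    rw [F.map_comp]; exact Idl.base _ _)

lemma Idl.eq_zero_left {A X Y : C} {f : X ⟶ Y} (hf : f ∈ Idl A X Y) (h : Hz X A) : f = 0 :=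
  Idl.ind hf ⊥ (fun a b => by simp [h a])

lemma Idl.eq_zero_right {A X Y : C} {f : X ⟶ Y} (hf : f ∈ Idl A X Y) (h : Hz A Y) : f = 0 :=
  Idl.ind hf ⊥ (fun a b => by simp [h b])

lemma Idl.biprod {A X Y : C} (hX : 𝟙 X ∈ Idl A X X) (hY : 𝟙 Y ∈ Idl A Y Y) :
    𝟙 (X ⊞ Y) ∈ Idl A (X ⊞ Y) (X ⊞ Y) := by
  rw [← biprod.total]
  refine add_mem ?_ ?_
  · simpa using Idl.comp_left biprod.fst (Idl.comp_right hX biprod.inl)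
  · simpa using Idl.comp_left biprod.snd (Idl.comp_right hY biprod.inr)

lemma Idl.inl (A B : C) : 𝟙 A ∈ Idl (A ⊞ B) A A := by
  simpa using Idl.base (A := A ⊞ B) biprod.inl biprod.fst

lemma Idl.inr (A B : C) : 𝟙 B ∈ Idl (A ⊞ B) B B := by
  simpa using Idl.base (A := A ⊞ B) biprod.inr biprod.snd

lemma Hz.of_idl_left {A A' Y : C} (hA : 𝟙 A ∈ Idl A' A A) (h : Hz A' Y) : Hz A Y := fun f => by
  have := Idl.comp_right hA f
  rw [Category.id_comp] at this
  exact Idl.eq_zero_right this h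

lemma Hz.of_idl_right {A A' X : C} (hA : 𝟙 A ∈ Idl A' A A) (i : ℤ) (h : Hz X (A'⟦i⟧)) :
    Hz X (A⟦i⟧) := fun f => by
  have := Idl.comp_left f (Idl.map hA (shiftFunctor C i))
  rw [CategoryTheory.Functor.map_id, Category.comp_id] at this
  exact Idl.eq_zero_left this h

/-- Every map to `W` from an object with no extensions to `A` factors through `add A`. -/
def Rf (d : ℕ) (A W : C) : Prop :=
  ∀ X : C, (∀ i : ℤ, 1 ≤ i → i ≤ (d : ℤ) - 1 → Hz X (A⟦i⟧)) → ∀ f : X ⟶ W, f ∈ Idl A X W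

lemma Rf.mono {d : ℕ} {A A' W : C} (hA : 𝟙 A ∈ Idl A' A A) (h : Rf d A W) : Rf d A' W :=
  fun X hX f => Idl.trans hA (h X (fun i h1 h2 => Hz.of_idl_right hA i (hX i h1 h2)) f)

lemma Rf.summand {d : ℕ} {A W W' : C} (hW : 𝟙 W' ∈ Idl W W' W') (h : Rf d A W) : Rf d A W' :=
  fun X hX f => by
    have h1 : f ∈ Idl W X W' := by simpa using Idl.comp_left f hW
    exact Idl.ind h1 _ (fun a b => Idl.comp_right (h X hX a) b)

lemma Rf.biprod {d : ℕ} {A W W' : C} (h : Rf d A W) (h' : Rf d A W') : Rf d A (W ⊞ W') :=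
  fun X hX f => by
    have : f = (f ≫ biprod.fst) ≫ biprod.inl + (f ≫ biprod.snd) ≫ biprod.inr := by
      rw [Category.assoc, Category.assoc, ← Preadditive.comp_add, biprod.total, Category.comp_id]
    rw [this]
    exact add_mem (Idl.comp_right (h X hX _) _) (Idl.comp_right (h' X hX _) _)

/-- Coresolutions by objects satisfying `Rf`. -/
def CoRes (d : ℕ) (A : C) : ℕ → C → Prop
  | 0, Y => Rf d A Y
  | n + 1, Y => ∃ (U Y' : C) (f : Y ⟶ U) (g : U ⟶ Y') (h : Y' ⟶ Y⟦(1:ℤ)⟧),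
      Triangle.mk f g h ∈ distTriang C ∧ Rf d A U ∧ CoRes d A n Y'

lemma CoRes.mono {d : ℕ} {A A' : C} (hA : 𝟙 A ∈ Idl A' A A) :
    ∀ (n : ℕ) (Y : C), CoRes d A n Y → CoRes d A' n Y
  | 0, _, h => Rf.mono hA h
  | n + 1, _, ⟨U, Y', f, g, h, hT, hU, hY⟩ =>
      ⟨U, Y', f, g, h, hT, hU.mono hA, CoRes.mono hA n Y' hY⟩

lemma exists_approx (k : Type w) [Field k] [Linear k C]
    [∀ X Y : C, FiniteDimensional k (X ⟶ Y)] (X A : C) :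
    ∃ (B : C) (b : X ⟶ B), 𝟙 B ∈ Idl A B B ∧ ∀ f : X ⟶ A, ∃ g : B ⟶ A, b ≫ g = f := by
  classical
  have key : ∀ s : Finset (X ⟶ A), ∃ (B : C) (b : X ⟶ B), 𝟙 B ∈ Idl A B B ∧
      ∀ f ∈ s, ∃ g : B ⟶ A, b ≫ g = f := by
    intro s
    induction s using Finset.induction_on with
    | empty =>
      obtain ⟨O, hO⟩ := (inferInstance : HasZeroObject C)
      refine ⟨O, 0, ?_, by simp⟩
      rw [hO.eq_of_src (𝟙 _) 0]; exact zero_mem _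
    | insert a s _ ih =>
      obtain ⟨B, b, hB, hb⟩ := ih
      refine ⟨B ⊞ A, biprod.lift b a, Idl.biprod hB (Idl.id A), ?_⟩
      intro f hf
      rcases Finset.mem_insert.1 hf with rfl | hf
      · exact ⟨biprod.snd, by simp⟩
      · obtain ⟨g, rfl⟩ := hb f hf
        exact ⟨biprod.fst ≫ g, by simp⟩
  obtain ⟨s, hs⟩ := (Module.finite_def.1 (inferInstance : Module.Finite k (X ⟶ A)))
  obtain ⟨B, b, hB, hb⟩ := key s
  refine ⟨B, b, hB, fun f => ?_⟩
  have hf : f ∈ Submodule.span k (s : Set (X ⟶ A)) := by rw [hs]; trivial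
  induction hf using Submodule.span_induction with
  | mem x hx => exact hb x hx
  | zero => exact ⟨0, by simp⟩
  | add x y _ _ hx hy =>
    obtain ⟨g, rfl⟩ := hx
    obtain ⟨g', rfl⟩ := hy
    exact ⟨g + g', by simp⟩
  | smul c x _ hx =>
    obtain ⟨g, rfl⟩ := hx
    exact ⟨c • g, by simp⟩

lemma approx_idl {X A B Y : C} {b : X ⟶ B} (hb : ∀ f : X ⟶ A, ∃ g : B ⟶ A, b ≫ g = f)
    {f : X ⟶ Y} (hf : f ∈ Idl A X Y) : ∃ g : B ⟶ Y, b ≫ g = f :=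
  Idl.ind hf (Preadditive.leftComp Y b).range (fun a c => by
    obtain ⟨g, rfl⟩ := hb a
    exact ⟨g ≫ c, by simp [Preadditive.leftComp]⟩)

/-- The key induction. -/
lemma key_lemma (k : Type w) [Field k] [Linear k C]
    [∀ X Y : C, FiniteDimensional k (X ⟶ Y)] (d : ℕ) (A : C)
    (hA : ∀ i : ℤ, 1 ≤ i → i ≤ (d : ℤ) - 1 → Hz A (A⟦i⟧)) :
    ∀ (n : ℕ) (K Y T : C), (∀ i : ℤ, 1 ≤ i → i ≤ (d : ℤ) - 1 → Hz K (A⟦i⟧)) →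
      CoRes d A n Y → (∀ i : ℤ, 1 ≤ i → i ≤ n → Hz A (T⟦i⟧)) →
      ∀ (e : K ⟶ Y) (D : Y ⟶ T), e ≫ D ∈ Idl A K T := by
  intro n
  induction n with
  | zero =>
    intro K Y T hK hY _ e D
    exact Idl.comp_right (hY K hK e) D
  | succ n ih =>
    rintro K Y T hK ⟨U, Y', f, g, h, hT, hU, hY'⟩ hAT e D
    obtain ⟨B, b, hB, hb⟩ := exists_approx k K A
    obtain ⟨K', b', c, hT'⟩ := distinguished_cocone_triangle b
    obtain ⟨u, hu⟩ := approx_idl hb (hU K hK (e ≫ f))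
    obtain ⟨e', he1, he2⟩ := dt_hom hT' hT e u hu
    have hK' : ∀ i : ℤ, 1 ≤ i → i ≤ (d : ℤ) - 1 → Hz K' (A⟦i⟧) := by
      intro i h1 h2 x
      have hBi : Hz B (A⟦i⟧) := Hz.of_idl_left hB (hA i h1 h2)
      obtain ⟨y, rfl⟩ := dt_y3 hT' x (hBi _)
      by_cases hi : i = 1
      · subst hi
        obtain ⟨z, rfl⟩ := (shiftFunctor C (1:ℤ)).map_surjective y
        obtain ⟨g, rfl⟩ := hb z
        have := dt_z31 hT'
        rw [CategoryTheory.Functor.map_comp, reassoc_of% this, zero_comp]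
      · have : Hz (K⟦(1:ℤ)⟧) (A⟦i⟧) :=
          (Hz.shift_iff K A 1 i (i - 1) (by omega)).2 (hK _ (by omega) (by omega))
        rw [this y, comp_zero]
    have h0 := ih K' Y' (T⟦(1:ℤ)⟧) hK' hY' (fun i h1 h2 =>
      (Hz.shift_shift_iff A T 1 i (i + 1) (by omega)).2 (hAT _ (by omega) (by push_cast; omega)))
      e' (h ≫ D⟦(1:ℤ)⟧')
    have h1 := Idl.eq_zero_right h0 (hAT 1 (by omega) (by push_cast; omega))
    have h2 : c ≫ (e ≫ D)⟦(1:ℤ)⟧' = 0 := by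
      rw [CategoryTheory.Functor.map_comp, reassoc_of% he2, h1]
    obtain ⟨y, hy⟩ := dt_y4 hT' _ h2
    obtain ⟨z, rfl⟩ := (shiftFunctor C (1:ℤ)).map_surjective y
    have h3 : e ≫ D = b ≫ (-z) := (shiftFunctor C (1:ℤ)).map_injective (by
      rw [hy]; simp)
    rw [h3]
    have := Idl.comp_left b (Idl.comp_right hB (-z))
    simpa using this

lemma idl_factor {orb : Set C} {A X Y : C} (hA : sums C orb A) {f : X ⟶ Y}
    (hf : f ∈ Idl A X Y) : ∃ (B : C) (a : X ⟶ B) (b : B ⟶ Y), sums C orb B ∧ a ≫ b = f := by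
  induction hf using AddSubgroup.closure_induction with
  | mem x hx => obtain ⟨a, b, rfl⟩ := hx; exact ⟨A, a, b, hA, rfl⟩
  | zero => exact ⟨A, 0, 0, hA, by simp⟩
  | add x y _ _ hx hy =>
    obtain ⟨B, a, b, hB, rfl⟩ := hx
    obtain ⟨B', a', b', hB', rfl⟩ := hy
    exact ⟨B ⊞ B', biprod.lift a a', biprod.desc b b', .biprod hB hB', by simp⟩
  | neg x _ hx =>
    obtain ⟨B, a, b, hB, rfl⟩ := hx
    exact ⟨B, a, -b, hB, by simp⟩

lemma mem_addSet_of_split {orb : Set C} {X B : C} (hB : sums C orb B) (a : X ⟶ B) (b : B ⟶ X)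
    (h : a ≫ b = 𝟙 X) : X ∈ addSet C orb := by
  obtain ⟨Z, p, q, hT⟩ := distinguished_cocone_triangle a
  have hq : q = 0 := by
    have h1 := dt_z31 hT
    have h2 : q ≫ (a ≫ b)⟦(1:ℤ)⟧' = 0 := by
      rw [CategoryTheory.Functor.map_comp, reassoc_of% h1, zero_comp]
    simpa [h] using h2
  obtain ⟨e, _⟩ := exists_iso_binaryBiproduct_of_distTriang _ hT hq
  exact ⟨B, Z, hB, ⟨e⟩⟩

lemma addSet_split {orb : Set C} {X : C} (h : X ∈ addSet C orb) :
    ∃ (B : C) (a : X ⟶ B) (b : B ⟶ X), sums C orb B ∧ a ≫ b = 𝟙 X := by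
  obtain ⟨B, Z, hB, ⟨e⟩⟩ := h
  exact ⟨B, biprod.inl ≫ e.inv, e.hom ≫ biprod.fst, hB, by simp⟩

lemma IsDCT.of_split {d : ℕ} {V : Set C} (hV : IsDCT d V) {X B : C} (hB : B ∈ V)
    (a : X ⟶ B) (b : B ⟶ X) (h : a ≫ b = 𝟙 X) : X ∈ V := by
  rw [← hV.add_closed]
  exact mem_addSet_of_split (.of hB) a b h

lemma IsDCT.of_sums {d : ℕ} {V orb : Set C} (hV : IsDCT d V) (ho : orb ⊆ V) {X : C}
    (h : sums C orb X) : X ∈ V := by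
  rw [← hV.add_closed]
  have h' : sums C V X := by
    induction h with
    | of h => exact .of (ho h)
    | biprod _ _ h1 h2 => exact .biprod h1 h2
  exact mem_addSet_of_split h' (𝟙 X) (𝟙 X) (by simp)

lemma IsDCT.biprod {d : ℕ} {V : Set C} (hV : IsDCT d V) {X Y : C} (hX : X ∈ V) (hY : Y ∈ V) :
    (X ⊞ Y) ∈ V := hV.of_sums subset_rfl (.biprod (.of hX) (.of hY))

lemma IsDCT.addSet_subset {d : ℕ} {V orb : Set C} (hV : IsDCT d V) (ho : orb ⊆ V) :
    addSet C orb ⊆ V := fun X hX => by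
  obtain ⟨B, a, b, hB, h⟩ := addSet_split hX
  exact hV.of_split (hV.of_sums ho hB) a b h

/-- Existence of coresolutions. -/
lemma exists_coRes {d : ℕ} (hd : 1 ≤ d) {U : Set C} (hU : IsDCT d U) {orb : Set C}
    (hR : ∀ W ∈ U, ∃ A, sums C orb A ∧ Rf d A W) :
    ∀ (n m : ℕ) (Y : C), m + n + 1 = d →
      (∀ B ∈ U, ∀ i : ℤ, 1 ≤ i → i ≤ m → Hz Y (B⟦i⟧)) →
      ∃ A, sums C orb A ∧ CoRes d A n Y := by
  intro n
  induction n with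
  | zero =>
    intro m Y hm hY
    exact hR Y (hU.perp_right Y (fun B hB i h1 h2 => hY B hB i h1 (by omega)))
  | succ n ih =>
    intro m Y hm hY
    obtain ⟨W, hW, f, hf⟩ := hU.cova Y
    obtain ⟨Y', g, h, hT⟩ := distinguished_cocone_triangle f
    obtain ⟨A', hA', hc⟩ := ih (m + 1) Y' (by omega) (by
      intro B hB i h1 h2 x
      have hBi : Hz W (B⟦i⟧) := hU.rigid W hW B hB i h1 (by push_cast at h2; omega)
      obtain ⟨y, rfl⟩ := dt_y3 hT x (hBi _)
      by_cases hi : i = 1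
      · subst hi
        obtain ⟨z, rfl⟩ := (shiftFunctor C (1:ℤ)).map_surjective y
        obtain ⟨t, rfl⟩ := hf B hB z
        have := dt_z31 hT
        rw [CategoryTheory.Functor.map_comp, reassoc_of% this, zero_comp]
      · have : Hz (Y⟦(1:ℤ)⟧) (B⟦i⟧) :=
          (Hz.shift_iff Y B 1 i (i - 1) (by omega)).2
            (hY B hB _ (by omega) (by push_cast at h2; omega))
        rw [this y, comp_zero])
    obtain ⟨A, hA, hr⟩ := hR W hW
    exact ⟨A ⊞ A', .biprod hA hA', W, Y', f, g, h, hT, hr.mono (Idl.inl _ _),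
      CoRes.mono (Idl.inr _ _) _ _ hc⟩

/-- The abstract comparison. -/
lemma subset_addSet (k : Type w) [Field k] [Linear k C]
    [∀ X Y : C, FiniteDimensional k (X ⟶ Y)] {d : ℕ} (hd : 1 ≤ d) {U V : Set C}
    (hU : IsDCT d U) (hV : IsDCT d V) {orb : Set C} (ho : orb ⊆ V)
    (hR : ∀ W ∈ U, ∃ A, sums C orb A ∧ Rf d A W) : V ⊆ addSet C orb := by
  intro X hX
  obtain ⟨A, hA, hc⟩ := exists_coRes hd hU hR (d - 1) 0 X (by omega)
    (fun B _ i h1 h2 => by simp at h2; omega)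
  have hAV := hV.of_sums ho hA
  have h := key_lemma k d A (hV.rigid A hAV A hAV) (d - 1) X X X (hV.rigid X hX A hAV) hc
    (fun i h1 h2 => hV.rigid A hAV X hX i h1 (by omega)) (𝟙 X) (𝟙 X)
  rw [Category.comp_id] at h
  obtain ⟨B, a, b, hB, hab⟩ := idl_factor hA h
  exact mem_addSet_of_split hB a b hab

/-- Every object satisfies `Rf` with respect to some object of `V`. -/
lemma exists_Rf_aux {d : ℕ} {V : Set C} (hV : IsDCT d V) :
    ∀ (n m : ℕ) (W : C), m + n + 1 = d →
      (∀ B ∈ V, ∀ i : ℤ, 1 ≤ i → i ≤ m → Hz B (W⟦i⟧)) →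
      ∃ A ∈ V, (∀ (X : C) (s : ℤ), (∀ i : ℤ, s ≤ i → i ≤ s + n → Hz X (A⟦i⟧)) → Hz X (W⟦s⟧)) ∧
        (∀ X : C, (∀ i : ℤ, 1 ≤ i → i ≤ n → Hz X (A⟦i⟧)) → ∀ f : X ⟶ W, f ∈ Idl A X W) := by
  intro n
  induction n with
  | zero =>
    intro m W hm hW
    refine ⟨W, hV.perp_left W (fun B hB i h1 h2 => hW B hB i h1 (by omega)), ?_, ?_⟩
    · intro X s h
      exact h s le_rfl (by simp)
    · intro X _ f
      simpa using Idl.base f (𝟙 W)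
  | succ n ih =>
    intro m W hm hW
    obtain ⟨A0, hA0, a, ha⟩ := hV.contra W
    obtain ⟨W', p, q, hT⟩ := distinguished_cocone_triangle₁ a
    obtain ⟨A', hA', h1', h2'⟩ := ih (m + 1) W' (by omega) (by
      intro B hB i h1 h2
      have hBi : Hz B (A0⟦i⟧) := hV.rigid B hB A0 hA0 i h1 (by push_cast at h2; omega)
      by_cases hi : i = 1
      · subst hi
        intro x
        obtain ⟨y, rfl⟩ := dt_c1 hT x (hBi _)
        obtain ⟨t, rfl⟩ := ha B hB y
        have := dt_z23 hT
        rw [Category.assoc, this, comp_zero]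
      · have hr := rot_of_distTriang _ (rot_of_distTriang _ hT)
        have h3 := Hz.mid_right hr B (i - 1) (hW B hB _ (by omega) (by push_cast at h2; omega))
          ((Hz.shift_shift_iff B A0 1 (i - 1) i (by omega)).2 hBi)
        exact (Hz.shift_shift_iff B W' 1 (i - 1) i (by omega)).1 h3)
    have hl := Idl.inl A0 A'
    have hr := Idl.inr A0 A'
    refine ⟨A0 ⊞ A', hV.biprod hA0 hA', ?_, ?_⟩
    · intro X s h
      refine Hz.mid_right (rot_of_distTriang _ hT) X s ?_ ?_
      · exact Hz.of_idl_right hl s (h s le_rfl (by push_cast; omega))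
      · refine (Hz.shift_shift_iff X W' 1 s (s + 1) (by omega)).2 (h1' X _ ?_)
        intro i hi1 hi2
        exact Hz.of_idl_right hr i (h i (by omega) (by push_cast; omega))
    · intro X h f
      have hz : Hz X (W'⟦(1:ℤ)⟧) := h1' X 1 (fun i hi1 hi2 =>
        Hz.of_idl_right hr i (h i hi1 (by push_cast; omega)))
      obtain ⟨g, rfl⟩ := dt_c3 hT f (hz _)
      have := Idl.comp_left g (Idl.comp_right hl a)
      simpa using this

lemma exists_Rf {d : ℕ} (hd : 1 ≤ d) {V : Set C} (hV : IsDCT d V) (W : C) :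
    ∃ A ∈ V, Rf d A W := by
  obtain ⟨A, hA, _, h⟩ := exists_Rf_aux hV (d - 1) 0 W (by omega)
    (fun B _ i h1 h2 => by simp at h2; omega)
  exact ⟨A, hA, fun X hX f => h X (fun i h1 h2 => hX i h1 (by omega)) f⟩

lemma Rf_of_addSet {d : ℕ} {orb orb' : Set C}
    (hR : ∀ W ∈ orb', ∃ A, sums C orb A ∧ Rf d A W) (W : C) (hW : W ∈ addSet C orb') :
    ∃ A, sums C orb A ∧ Rf d A W := by
  obtain ⟨B, a, b, hB, hab⟩ := addSet_split hW
  have key : ∃ A, sums C orb A ∧ Rf d A B := by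
    clear hab hW a b
    induction hB with
    | of h => exact hR _ h
    | biprod _ _ h1 h2 =>
      obtain ⟨A, hA, h⟩ := h1
      obtain ⟨A', hA', h'⟩ := h2
      exact ⟨A ⊞ A', .biprod hA hA', (h.mono (Idl.inl _ _)).biprod (h'.mono (Idl.inr _ _))⟩
  obtain ⟨A, hA, h⟩ := key
  exact ⟨A, hA, h.summand (by rw [← hab]; exact Idl.base a b)⟩

section Serre

variable (S : SerreFunctor k C) (d : ℕ)

lemma serre_iff (X Y : C) : Hz Y (S.ν.functor.obj X) ↔ Hz X Y := by
  constructor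
  · intro h f
    have h0 : ∀ φ : Module.Dual k (X ⟶ Y), φ f = 0 := by
      intro φ
      obtain ⟨g, rfl⟩ := (S.duality X Y).surjective φ
      rw [h g]; simp
    exact (Module.forall_dual_apply_eq_zero_iff k f).1 h0
  · intro h f
    apply (S.duality X Y).injective
    ext g
    rw [h g]; simp

lemma nud_right_iff (A X : C) (i j : ℤ) (h : i + j = d) :
    Hz A (((nud S d).obj X)⟦i⟧) ↔ Hz X (A⟦j⟧) := by
  rw [← Hz.shift_left_iff A _ (-i) i (by omega)]
  change Hz (A⟦-i⟧) (S.ν.functor.obj (X⟦-(d:ℤ)⟧)) ↔ _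
  rw [serre_iff, Hz.shift_iff X A (-(d:ℤ)) (-i) j (by omega)]

lemma nud_iff (X A : C) (i : ℤ) :
    Hz ((nud S d).obj X) (((nud S d).obj A)⟦i⟧) ↔ Hz X (A⟦i⟧) := by
  rw [nud_right_iff S d _ A i (d - i) (by omega), nud_right_iff S d A X (d - i) i (by omega)]

instance nud_additive : (nud S d).Additive := by
  haveI := S.additive
  unfold nud; infer_instance

instance nud_isEquivalence : (nud S d).IsEquivalence := by
  unfold nud; infer_instance

instance nudInv_isEquivalence : (nudInv S d).IsEquivalence := by
  unfold nudInv; infer_instance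

instance nudInv_additive : (nudInv S d).Additive := by
  haveI := S.additive
  haveI : S.ν.inverse.Additive := S.ν.inverse_additive
  unfold nudInv; infer_instance

/-- `ν_d ν_d⁻¹ ≅ 1` on objects. -/
def nudCounit (X : C) : (nud S d).obj ((nudInv S d).obj X) ≅ X :=
  S.ν.functor.mapIso ((shiftFunctorCompIsoId C (d : ℤ) (-(d : ℤ)) (by omega)).app
    (S.ν.inverse.obj X)) ≪≫ S.ν.counitIso.app X

lemma nudInv_iff (X A : C) (i : ℤ) :
    Hz ((nudInv S d).obj X) (((nudInv S d).obj A)⟦i⟧) ↔ Hz X (A⟦i⟧) := by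
  rw [← nud_iff S d]
  let e := nudCounit S d X
  let e' := (shiftFunctor C i).mapIso (nudCounit S d A)
  exact ⟨fun h => (h.iso_left e).iso_right e', fun h => (h.iso_left e.symm).iso_right e'.symm⟩

lemma Rf.functor {A W : C} (h : Rf d A W) (F : C ⥤ C) [F.Additive] [F.IsEquivalence]
    (hF : ∀ (X A : C) (i : ℤ), Hz (F.obj X) ((F.obj A)⟦i⟧) ↔ Hz X (A⟦i⟧)) :
    Rf d (F.obj A) (F.obj W) := by
  intro X hX f
  let e := F.objObjPreimageIso X
  obtain ⟨g, hg⟩ := F.map_surjective (e.hom ≫ f)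
  have hm := h (F.objPreimage X) (fun i h1 h2 => (hF _ _ i).1 ((hX i h1 h2).iso_left e.symm)) g
  have := Idl.comp_left e.inv (Idl.map hm F)
  rw [hg] at this
  simpa using this

lemma Rf.iter {A W : C} (h : Rf d A W) (F : C ⥤ C) [F.Additive] [F.IsEquivalence]
    (hF : ∀ (X A : C) (i : ℤ), Hz (F.obj X) ((F.obj A)⟦i⟧) ↔ Hz X (A⟦i⟧)) :
    ∀ n : ℕ, Rf d (iterObj C F n A) (iterObj C F n W)
  | 0 => h
  | n + 1 => (Rf.iter h F hF n).functor d F hF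

lemma Rf.iso {A W W' : C} (h : Rf d A W) (e : W' ≅ W) : Rf d A W' :=
  h.summand (by rw [← e.hom_inv_id]; exact Idl.base _ _)

lemma orbit_Rf {A G : C} (h : Rf d A G) (W : C) (hW : W ∈ nudOrbit S d G) :
    ∃ B, sums C (nudOrbit S d A) B ∧ Rf d B W := by
  obtain ⟨n, he | he⟩ := hW <;> obtain ⟨e⟩ := he
  · exact ⟨_, .of ⟨n, Or.inl ⟨Iso.refl _⟩⟩, (h.iter d _ (nud_iff S d) n).iso d e⟩
  · exact ⟨_, .of ⟨n, Or.inr ⟨Iso.refl _⟩⟩, (h.iter d _ (nudInv_iff S d) n).iso d e⟩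

variable {d} {V : Set C}

lemma nud_mem (hV : IsDCT d V) {X : C} (hX : X ∈ V) : (nud S d).obj X ∈ V :=
  hV.perp_left _ (fun A hA i h1 h2 =>
    (nud_right_iff S d A X i (d - i) (by omega)).2
      (hV.rigid X hX A hA _ (by omega) (by omega)))

lemma nudInv_mem (hV : IsDCT d V) {X : C} (hX : X ∈ V) : (nudInv S d).obj X ∈ V :=
  hV.perp_right _ (fun A hA i h1 h2 => by
    refine (nud_right_iff S d A _ (d - i) i (by omega)).1 ?_
    have h : Hz A (X⟦(d:ℤ) - i⟧) := hV.rigid A hA X hX _ (by omega) (by omega)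
    exact h.iso_right ((shiftFunctor C ((d:ℤ) - i)).mapIso (nudCounit S d X).symm))

lemma iter_mem {F : C ⥤ C} (hF : ∀ X ∈ V, F.obj X ∈ V) {X : C} (hX : X ∈ V) :
    ∀ n : ℕ, iterObj C F n X ∈ V
  | 0 => hX
  | n + 1 => hF _ (iter_mem hF hX n)

lemma orbit_subset (hV : IsDCT d V) {X : C} (hX : X ∈ V) : nudOrbit S d X ⊆ V := by
  rintro Y ⟨n, he | he⟩ <;> obtain ⟨e⟩ := he
  · exact hV.of_split (iter_mem (fun _ h => nud_mem S hV h) hX n) e.hom e.inv (by simp)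
  · exact hV.of_split (iter_mem (fun _ h => nudInv_mem S hV h) hX n) e.hom e.inv (by simp)

end Serre

theorem statement_4
    [∀ X Y : C, FiniteDimensional k (X ⟶ Y)] [IsIdempotentComplete C]
    (S : SerreFunctor k C) (d : ℕ) (hd : 1 ≤ d) :
    ((∃ U : Set C, IsDCT d U ∧ HasAddGen U) →
      ∀ V : Set C, IsDCT d V → HasAddGen V) ∧
    ((∃ U : Set C, IsDCT d U ∧ HasNudGen S d U) →
      ∀ V : Set C, IsDCT d V → HasNudGen S d V) := by
  constructor
  · rintro ⟨U, hU, G, hG, hGU⟩ V hV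
    obtain ⟨A, hA, hR⟩ := exists_Rf hd hV G
    have ho : ({A} : Set C) ⊆ V := by simpa using hA
    refine ⟨A, hA, Set.Subset.antisymm ?_ (hV.addSet_subset ho)⟩
    refine subset_addSet k hd hU hV ho (fun W hW => ?_)
    rw [hGU] at hW
    refine Rf_of_addSet ?_ W hW
    rintro _ rfl
    exact ⟨A, .of rfl, hR⟩
  · rintro ⟨U, hU, G, hG, hGU⟩ V hV
    obtain ⟨A, hA, hR⟩ := exists_Rf hd hV G
    have ho := orbit_subset S hV hA
    refine ⟨A, hA, Set.Subset.antisymm ?_ (hV.addSet_subset ho)⟩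
    refine subset_addSet k hd hU hV ho (fun W hW => ?_)
    rw [hGU] at hW
    exact Rf_of_addSet (orbit_Rf S d hR) W hW
end

section
/- Let C be a Krull-Schmidt triangulated category with a Serre functor ν, and let U ⊆ C be a d-cluster tilting subcategory which is locally bounded. Then there is a decomposition C ≃ C_p × C_a of triangulated categories such that every object in U ∩ C_p is ν_d-periodic and every indecomposable object in U ∩ C_a is not ν_d-periodic. -/
/-!
STATEMENT 5: If C is a Krull-Schmidt triangulated category with a Serre functor and
U ⊆ C is a locally bounded d-cluster tilting subcategory, then C decomposes as
C ≃ C_p × C_a (mutually orthogonal, every object a direct sum) such that every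
object of U ∩ C_p is ν_d-periodic and no indecomposable object of U ∩ C_a is.
-/

open CategoryTheory CategoryTheory.Limits CategoryTheory.Pretriangulated

universe w v u

variable (k : Type w) [Field k]
variable (C : Type u) [Category.{v} C] [Preadditive C] [Linear k C] [HasZeroObject C]
  [HasShift C ℤ] [∀ n : ℤ, (CategoryTheory.shiftFunctor C n).Additive] [Pretriangulated C]
  [HasBinaryBiproducts C]

variable {k C}

/-- An object is indecomposable. -/
def Indecomp (X : C) : Prop :=
  ¬ IsZero X ∧ ∀ (Y Z : C), (X ≅ Y ⊞ Z) → IsZero Y ∨ IsZero Z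

/-- `X` is ν_d-periodic: ν_d^m(X) ≅ X for some m ≠ 0. -/
def NudPeriodic (S : SerreFunctor k C) (d : ℕ) (X : C) : Prop :=
  ∃ m : ℕ, 0 < m ∧ Nonempty (iterObj C (nud S d) m X ≅ X)

/-- `U` is locally bounded: for each A ∈ U there are, up to isomorphism, only
finitely many indecomposables B ∈ U with a nonzero morphism to or from A. -/
def LocallyBounded (U : Set C) : Prop :=
  ∀ A ∈ U, ∃ s : Finset C, ∀ B ∈ U, Indecomp B →
    ((∃ f : B ⟶ A, f ≠ 0) ∨ (∃ f : A ⟶ B, f ≠ 0)) → ∃ B' ∈ s, Nonempty (B ≅ B')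

section helpers

set_option linter.unusedSectionVars false

def NZ (X Y : C) : Prop := ∃ f : X ⟶ Y, f ≠ 0

lemma NZ.iso {X Y X' Y' : C} (h : NZ X Y) (a : X ≅ X') (b : Y ≅ Y') : NZ X' Y' := by
  obtain ⟨f, hf⟩ := h
  refine ⟨a.inv ≫ f ≫ b.hom, fun h0 => hf ?_⟩
  have : a.hom ≫ (a.inv ≫ f ≫ b.hom) ≫ b.inv = 0 := by rw [h0]; simp
  simpa using this

lemma nz_map (F : C ⥤ C) [F.Additive] [F.Full] [F.Faithful] (X Y : C) :
    NZ (F.obj X) (F.obj Y) ↔ NZ X Y := by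
  constructor
  · rintro ⟨f, hf⟩
    obtain ⟨g, rfl⟩ := F.map_surjective f
    exact ⟨g, fun h => hf (by rw [h]; simp)⟩
  · rintro ⟨f, hf⟩
    exact ⟨F.map f, fun h => hf (F.map_injective (by rw [h]; simp))⟩

lemma nz_shift (X Y : C) (n : ℤ) : NZ (X⟦n⟧) (Y⟦n⟧) ↔ NZ X Y := nz_map _ X Y

lemma nz_adj (X Y : C) (n : ℤ) : NZ X (Y⟦n⟧) ↔ NZ (X⟦-n⟧) Y := by
  rw [← nz_shift (X⟦-n⟧) Y n]
  exact ⟨fun h => h.iso (shiftNegShift X n).symm (Iso.refl _),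
    fun h => h.iso (shiftNegShift X n) (Iso.refl _)⟩

lemma nz_adj' (X Y : C) (n : ℤ) : NZ (X⟦n⟧) Y ↔ NZ X (Y⟦-n⟧) := by
  rw [← nz_shift X (Y⟦-n⟧) n]
  exact ⟨fun h => h.iso (Iso.refl _) (shiftNegShift Y n).symm,
    fun h => h.iso (Iso.refl _) (shiftNegShift Y n)⟩

lemma nz_serre (S : SerreFunctor k C) (X Y : C) :
    NZ Y (S.ν.functor.obj X) ↔ NZ X Y := by
  constructor
  · rintro ⟨f, hf⟩
    by_contra hn
    apply hf
    apply (S.duality X Y).injective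
    ext g
    have : g = 0 := by
      by_contra hg
      exact hn ⟨g, hg⟩
    rw [this]; simp
  · rintro ⟨g, hg⟩
    by_contra hn
    apply hg
    rw [← Module.forall_dual_apply_eq_zero_iff k]
    intro φ
    have : (S.duality X Y).symm φ = 0 := by
      by_contra hf
      exact hn ⟨_, hf⟩
    rw [LinearEquiv.map_eq_zero_iff] at this
    rw [this]; simp

instance nud_equiv (S : SerreFunctor k C) (d : ℕ) : (nud S d).IsEquivalence := by
  unfold nud; infer_instance

instance nud_add (S : SerreFunctor k C) (d : ℕ) : (nud S d).Additive := by
  have := S.additive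
  unfold nud; infer_instance

lemma nz_nud_shift (S : SerreFunctor k C) (d : ℕ) (A B : C) (n : ℤ) :
    NZ A (B⟦n⟧) ↔ NZ ((nud S d).obj A) (((nud S d).obj B)⟦n⟧) := by
  rw [nz_adj _ ((nud S d).obj B)]
  change _ ↔ NZ _ (S.ν.functor.obj (B⟦-(d:ℤ)⟧))
  rw [nz_serre, ← nz_adj']
  change _ ↔ NZ _ (S.ν.functor.obj (A⟦-(d:ℤ)⟧))
  rw [nz_serre, ← nz_shift A (B⟦n⟧) (-(d:ℤ))]
  exact ⟨fun h => h.iso (Iso.refl _) (shiftComm B _ _), fun h => h.iso (Iso.refl _) (shiftComm B _ _)⟩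

/-! iteration -/

def iterIso (F : C ⥤ C) {X Y : C} (e : X ≅ Y) : ∀ n, iterObj C F n X ≅ iterObj C F n Y
  | 0 => e
  | n + 1 => F.mapIso (iterIso F e n)

lemma iterObj_add (F : C ⥤ C) (X : C) (m n : ℕ) :
    iterObj C F (m + n) X = iterObj C F m (iterObj C F n X) := by
  induction m with
  | zero => simp [iterObj]
  | succ m ih => rw [Nat.succ_add]; simp only [iterObj]; rw [ih]

lemma iter_mul (F : C ⥤ C) (X : C) (m : ℕ) (h : Nonempty (iterObj C F m X ≅ X)) (j : ℕ) :
    Nonempty (iterObj C F (m * j) X ≅ X) := by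
  obtain ⟨e⟩ := h
  induction j with
  | zero => exact ⟨Iso.refl _⟩
  | succ j ih =>
    obtain ⟨e'⟩ := ih
    rw [Nat.mul_succ, iterObj_add]
    exact ⟨iterIso F e _ ≪≫ e'⟩

lemma iter_cancel (F : C ⥤ C) [F.Full] [F.Faithful] (X Y : C) (m : ℕ)
    (h : Nonempty (iterObj C F m X ≅ iterObj C F m Y)) : Nonempty (X ≅ Y) := by
  induction m with
  | zero => exact h
  | succ m ih => exact ih ⟨F.preimageIso h.some⟩

lemma iter_biprod (F : C ⥤ C) [F.Additive] (X Y : C) (m : ℕ) :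
    Nonempty (iterObj C F m (X ⊞ Y) ≅ iterObj C F m X ⊞ iterObj C F m Y) := by
  have := preservesBinaryBiproducts_of_preservesBiproducts F
  induction m with
  | zero => exact ⟨Iso.refl _⟩
  | succ m ih =>
    obtain ⟨e⟩ := ih
    exact ⟨F.mapIso e ≪≫ F.mapBiprod _ _⟩

lemma isZero_map_iff (F : C ⥤ C) [F.IsEquivalence] [F.Additive] (X : C) :
    IsZero (F.obj X) ↔ IsZero X := by
  rw [IsZero.iff_id_eq_zero, IsZero.iff_id_eq_zero, ← F.map_id]
  constructor
  · intro h; exact F.map_injective (by rw [h]; simp)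
  · intro h; rw [h]; simp

lemma indecomp_map (F : C ⥤ C) [F.IsEquivalence] [F.Additive] (X : C) (h : Indecomp X) :
    Indecomp (F.obj X) := by
  refine ⟨fun h0 => h.1 ((isZero_map_iff F X).1 h0), fun Y Z e => ?_⟩
  have := preservesBinaryBiproducts_of_preservesBiproducts F
  let eY : Y ≅ F.obj (F.objPreimage Y) := (F.objObjPreimageIso Y).symm
  let eZ : Z ≅ F.obj (F.objPreimage Z) := (F.objObjPreimageIso Z).symm
  let e' : X ≅ F.objPreimage Y ⊞ F.objPreimage Z :=
    F.preimageIso (e ≪≫ biprod.mapIso eY eZ ≪≫ (F.mapBiprod _ _).symm)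
  rcases h.2 _ _ e' with h | h
  · exact Or.inl (((isZero_map_iff F _).2 h).of_iso eY)
  · exact Or.inr (((isZero_map_iff F _).2 h).of_iso eZ)

/-! Krull-Schmidt induction -/

lemma ks_ind (k : Type w) [Field k] [Linear k C] [∀ X Y : C, FiniteDimensional k (X ⟶ Y)]
    (Q : C → Prop) (h0 : ∀ X, IsZero X → Q X)
    (hi : ∀ X, Indecomp X → Q X) (hb : ∀ X Y Z, (X ≅ Y ⊞ Z) → Q Y → Q Z → Q X) : ∀ X, Q X := by
  have pos : ∀ X : C, ¬ IsZero X → 0 < Module.finrank k (X ⟶ X) := by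
    intro X hX
    rw [Module.finrank_pos_iff_exists_ne_zero]
    exact ⟨𝟙 X, fun h => hX ((IsZero.iff_id_eq_zero X).2 h)⟩
  have le : ∀ X Y Z : C, (X ≅ Y ⊞ Z) →
      Module.finrank k (Y ⟶ Y) + Module.finrank k (Z ⟶ Z) ≤ Module.finrank k (X ⟶ X) := by
    intro X Y Z e
    rw [← Module.finrank_prod]
    let L : ((Y ⟶ Y) × (Z ⟶ Z)) →ₗ[k] (X ⟶ X) :=
      { toFun := fun p => e.hom ≫ (biprod.fst ≫ p.1 ≫ biprod.inl + biprod.snd ≫ p.2 ≫ biprod.inr) ≫ e.inv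
        map_add' := by intro p q; simp; abel
        map_smul' := by intro r p; simp }
    apply LinearMap.finrank_le_finrank_of_injective (f := L)
    rw [← LinearMap.ker_eq_bot, LinearMap.ker_eq_bot']
    rintro ⟨f, g⟩ h
    have h1 : e.hom ≫ (biprod.fst ≫ f ≫ biprod.inl + biprod.snd ≫ g ≫ biprod.inr) ≫ e.inv = 0 := h
    have h2 : biprod.fst ≫ f ≫ biprod.inl + biprod.snd ≫ g ≫ biprod.inr = (0 : Y ⊞ Z ⟶ Y ⊞ Z) := by
      have : e.inv ≫ (e.hom ≫ (biprod.fst ≫ f ≫ biprod.inl + biprod.snd ≫ g ≫ biprod.inr) ≫ e.inv) ≫ e.hom = 0 := by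
        rw [h1]; simp
      simpa using this
    ext
    · have : biprod.inl ≫ (biprod.fst ≫ f ≫ biprod.inl + biprod.snd ≫ g ≫ biprod.inr) ≫ biprod.fst = (0 : Y ⟶ Y) := by
        rw [h2]; simp
      simpa using this
    · have : biprod.inr ≫ (biprod.fst ≫ f ≫ biprod.inl + biprod.snd ≫ g ≫ biprod.inr) ≫ biprod.snd = (0 : Z ⟶ Z) := by
        rw [h2]; simp
      simpa using this
  intro X
  induction hn : Module.finrank k (X ⟶ X) using Nat.strong_induction_on generalizing X with
  | _ n ih =>
    by_cases hX : IsZero X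
    · exact h0 X hX
    by_cases hI : Indecomp X
    · exact hi X hI
    simp only [Indecomp, not_and, not_forall, not_or] at hI
    obtain ⟨Y, Z, e, hY, hZ⟩ := hI hX
    have := le X Y Z e
    have := pos Y hY
    have := pos Z hZ
    exact hb X Y Z e (ih _ (by omega) Y rfl) (ih _ (by omega) Z rfl)

/-! cluster tilting -/

lemma nud_mem_s5 (S : SerreFunctor k C) {d : ℕ} {U : Set C} (hU : IsDCT d U) {A : C} (hA : A ∈ U) :
    (nud S d).obj A ∈ U := by
  apply hU.perp_left
  intro B hB i hi1 hi2 f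
  by_contra hf
  have h : NZ B (((nud S d).obj A)⟦i⟧) := ⟨f, hf⟩
  rw [nz_adj] at h
  change NZ _ (S.ν.functor.obj (A⟦-(d:ℤ)⟧)) at h
  rw [nz_serre, nz_adj'] at h
  obtain ⟨g, hg⟩ := h.iso (Iso.refl A)
    ((shiftFunctorAdd' C (-i) (- -(d:ℤ)) (d - i) (by ring)).app B).symm
  exact hg (hU.rigid A hA B hB (d - i) (by omega) (by omega) g)

lemma iter_mem_s5 (S : SerreFunctor k C) {d : ℕ} {U : Set C} (hU : IsDCT d U) {A : C} (hA : A ∈ U)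
    (m : ℕ) : iterObj C (nud S d) m A ∈ U := by
  induction m with
  | zero => exact hA
  | succ m ih => exact nud_mem_s5 S hU ih

lemma iter_indecomp (S : SerreFunctor k C) {d : ℕ} {A : C} (hA : Indecomp A)
    (m : ℕ) : Indecomp (iterObj C (nud S d) m A) := by
  induction m with
  | zero => exact hA
  | succ m ih => exact indecomp_map _ _ ih

lemma nz_iter (S : SerreFunctor k C) (d : ℕ) (A B : C) (n : ℤ) (m : ℕ) (h : NZ A (B⟦n⟧)) :
    NZ (iterObj C (nud S d) m A) ((iterObj C (nud S d) m B)⟦n⟧) := by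
  induction m with
  | zero => exact h
  | succ m ih => exact (nz_nud_shift S d _ _ n).1 ih

/-- Pigeonhole: if all `ν_d^{mi} B` lie in finitely many iso classes, `B` is periodic. -/
lemma periodic_of_finite (S : SerreFunctor k C) (d : ℕ) (B : C) (m : ℕ) (hm : 0 < m)
    (s : Finset C) (h : ∀ i : ℕ, ∃ B' ∈ s, Nonempty (iterObj C (nud S d) (m * i) B ≅ B')) :
    NudPeriodic S d B := by
  choose f hf e using h
  obtain ⟨i, -, j, -, hij, hEq⟩ := Set.infinite_univ.exists_ne_map_eq_of_mapsTo
    (f := f) (t := (s : Set C)) (fun i _ => hf i) s.finite_toSet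
  have key : ∀ i j : ℕ, i < j → f i = f j → NudPeriodic S d B := by
    intro i j hlt hEq
    obtain ⟨ei⟩ := e i
    obtain ⟨ej⟩ := e j
    refine ⟨m * (j - i), Nat.mul_pos hm (by omega), ?_⟩
    apply iter_cancel (nud S d) _ _ (m * i)
    rw [← iterObj_add, ← Nat.mul_add, Nat.add_sub_cancel' hlt.le]
    exact ⟨ej ≪≫ eqToIso hEq.symm ≪≫ ei.symm⟩
  rcases lt_or_gt_of_ne hij with h | h
  · exact key i j h hEq
  · exact key j i h hEq.symm

lemma periodic_right (S : SerreFunctor k C) {d : ℕ} {U : Set C} (hU : IsDCT d U)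
    (hlb : LocallyBounded U) {A B : C} (hB : B ∈ U) (hBi : Indecomp B)
    (hA : NudPeriodic S d A) (n : ℤ) (h : NZ A (B⟦n⟧)) : NudPeriodic S d B := by
  obtain ⟨m, hm, hA⟩ := hA
  obtain ⟨A', hA', f, hf⟩ := hU.cova (A⟦-n⟧)
  obtain ⟨s, hs⟩ := hlb A' hA'
  refine periodic_of_finite S d B m hm s fun i => ?_
  refine hs _ (iter_mem_s5 S hU hB _) (iter_indecomp S hBi _) (Or.inr ?_)
  have h1 := (nz_iter S d A B n (m * i) h).iso (iter_mul _ _ _ hA i).some (Iso.refl _)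
  rw [nz_adj] at h1
  obtain ⟨g, hg⟩ := h1
  obtain ⟨t, ht⟩ := hf _ (iter_mem_s5 S hU hB _) g
  exact ⟨t, fun h0 => hg (by rw [← ht, h0]; simp)⟩

lemma periodic_left (S : SerreFunctor k C) {d : ℕ} {U : Set C} (hU : IsDCT d U)
    (hlb : LocallyBounded U) {A B : C} (hB : B ∈ U) (hBi : Indecomp B)
    (hA : NudPeriodic S d A) (n : ℤ) (h : NZ B (A⟦n⟧)) : NudPeriodic S d B := by
  obtain ⟨m, hm, hA⟩ := hA
  obtain ⟨A', hA', f, hf⟩ := hU.contra (A⟦n⟧)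
  obtain ⟨s, hs⟩ := hlb A' hA'
  refine periodic_of_finite S d B m hm s fun i => ?_
  refine hs _ (iter_mem_s5 S hU hB _) (iter_indecomp S hBi _) (Or.inl ?_)
  obtain ⟨g, hg⟩ := (nz_iter S d B A n (m * i) h).iso (Iso.refl _)
    ((shiftFunctor C n).mapIso (iter_mul _ _ _ hA i).some)
  obtain ⟨t, ht⟩ := hf _ (iter_mem_s5 S hU hB _) g
  exact ⟨t, fun h0 => hg (by rw [← ht, h0]; simp)⟩

/-! decompositions -/

/-- mutually Hom-orthogonal -/
def Orth (X Y : C) : Prop := ¬ NZ X Y ∧ ¬ NZ Y X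

lemma nz_of_biprod_left {X Y Z W : C} (e : X ≅ Y ⊞ Z) (h : NZ Y W) : NZ X W := by
  obtain ⟨f, hf⟩ := h
  refine NZ.iso ⟨biprod.fst ≫ f, fun h0 => hf ?_⟩ e.symm (Iso.refl _)
  have : (biprod.inl : Y ⟶ Y ⊞ Z) ≫ biprod.fst ≫ f = 0 := by rw [h0]; simp
  simpa using this

lemma nz_of_biprod_right {X Y Z W : C} (e : X ≅ Y ⊞ Z) (h : NZ W Y) : NZ W X := by
  obtain ⟨f, hf⟩ := h
  refine NZ.iso ⟨f ≫ biprod.inl, fun h0 => hf ?_⟩ (Iso.refl _) e.symm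
  have : (f ≫ (biprod.inl : Y ⟶ Y ⊞ Z)) ≫ biprod.fst = 0 := by rw [h0]; simp
  simpa using this

lemma orth_summand {X Y Z W : C} (e : X ≅ Y ⊞ Z) (h : Orth X W) : Orth Y W :=
  ⟨fun h' => h.1 (nz_of_biprod_left e h'), fun h' => h.2 (nz_of_biprod_right e h')⟩

lemma orth_ext {T : Triangle C} (hT : T ∈ distTriang C) (W : C) (h1 : Orth T.obj₁ W)
    (h3 : Orth T.obj₃ W) : Orth T.obj₂ W := by
  constructor
  · rintro ⟨f, hf⟩
    have : T.mor₁ ≫ f = 0 := by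
      by_contra h; exact h1.1 ⟨_, h⟩
    obtain ⟨g, rfl⟩ := Triangle.yoneda_exact₂ T hT f this
    exact h3.1 ⟨g, fun h => hf (by rw [h]; simp)⟩
  · rintro ⟨f, hf⟩
    have : f ≫ T.mor₂ = 0 := by
      by_contra h; exact h3.2 ⟨_, h⟩
    obtain ⟨g, rfl⟩ := Triangle.coyoneda_exact₂ T hT f this
    exact h1.2 ⟨g, fun h => hf (by rw [h]; simp)⟩

noncomputable def piBoolIso (X : Bool → C) [HasProduct X] : (∏ᶜ X) ≅ X true ⊞ X false where
  hom := biprod.lift (Pi.π X true) (Pi.π X false)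
  inv := Pi.lift (fun b => Bool.rec biprod.snd biprod.fst b)
  hom_inv_id := by
    apply Pi.hom_ext
    intro b
    cases b <;> simp
  inv_hom_id := by
    ext <;> simp

lemma orth_zero {T T' : C} (h : Orth T T') : (∀ f : T ⟶ T', f = 0) ∧ (∀ f : T' ⟶ T, f = 0) :=
  ⟨fun f => by by_contra hf; exact h.1 ⟨f, hf⟩, fun f => by by_contra hf; exact h.2 ⟨f, hf⟩⟩

def Dec (Cp Ca : Set C) (X : C) : Prop := ∃ P ∈ Cp, ∃ A ∈ Ca, Nonempty (X ≅ P ⊞ A)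

/-- One factor of the morphism to the product triangle. -/
lemma tri_factor {T : Triangle C} (hT : T ∈ distTriang C) {A A' B B' : C}
    (a : T.obj₁ ≅ A ⊞ A') (b : T.obj₃ ≅ B ⊞ B') (h0 : ∀ f : B' ⟶ A⟦(1:ℤ)⟧, f = 0) :
    ∃ (T' : Triangle C) (_ : T' ∈ distTriang C) (e₁ : T'.obj₁ = A) (e₃ : T'.obj₃ = B)
      (φ : T ⟶ T'), φ.hom₁ ≫ eqToHom e₁ = a.hom ≫ biprod.fst ∧
        φ.hom₃ ≫ eqToHom e₃ = b.hom ≫ biprod.fst := by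
  let h : B ⟶ A⟦(1:ℤ)⟧ := biprod.inl ≫ b.inv ≫ T.mor₃ ≫ (a.hom ≫ biprod.fst)⟦(1:ℤ)⟧'
  obtain ⟨Y, f, g, hY⟩ := distinguished_cocone_triangle₂ h
  have comm : T.mor₃ ≫ (a.hom ≫ biprod.fst)⟦(1:ℤ)⟧' = (b.hom ≫ biprod.fst) ≫ h := by
    rw [← cancel_epi b.inv]
    apply biprod.hom_ext'
    · simp [h]
    · rw [h0 (biprod.inr ≫ b.inv ≫ T.mor₃ ≫ (a.hom ≫ biprod.fst)⟦(1:ℤ)⟧')]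
      simp
  obtain ⟨c, hc1, hc2⟩ := complete_distinguished_triangle_morphism₂ T (Triangle.mk f g h) hT hY
    (a.hom ≫ biprod.fst) (b.hom ≫ biprod.fst) comm
  refine ⟨Triangle.mk f g h, hY, rfl, rfl,
    { hom₁ := a.hom ≫ biprod.fst, hom₂ := c, hom₃ := b.hom ≫ biprod.fst
      comm₁ := hc1, comm₂ := hc2, comm₃ := comm }, Category.comp_id _, Category.comp_id _⟩

lemma dec_ext (Cp Ca : Set C) (horth : ∀ P ∈ Cp, ∀ A ∈ Ca, Orth P A)
    (hp1 : ∀ P ∈ Cp, P⟦(1:ℤ)⟧ ∈ Cp) (ha1 : ∀ P ∈ Ca, P⟦(1:ℤ)⟧ ∈ Ca)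
    (hp : ∀ T ∈ distTriang C, T.obj₁ ∈ Cp → T.obj₃ ∈ Cp → T.obj₂ ∈ Cp)
    (ha : ∀ T ∈ distTriang C, T.obj₁ ∈ Ca → T.obj₃ ∈ Ca → T.obj₂ ∈ Ca)
    (T : Triangle C) (hT : T ∈ distTriang C) (h1 : Dec Cp Ca T.obj₁) (h3 : Dec Cp Ca T.obj₃) :
    Dec Cp Ca T.obj₂ := by
  obtain ⟨A, hA, A', hA', ⟨a⟩⟩ := h1
  obtain ⟨B, hB, B', hB', ⟨b⟩⟩ := h3
  obtain ⟨T₁, hT₁, rfl, rfl, φ, hφ1, hφ3⟩ := tri_factor hT a b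
    (orth_zero (horth _ (hp1 _ hA) _ hB')).2
  obtain ⟨T₂, hT₂, rfl, rfl, ψ, hψ1, hψ3⟩ := tri_factor hT (a ≪≫ biprod.braiding _ _)
    (b ≪≫ biprod.braiding _ _) (orth_zero (horth _ hB _ (ha1 _ hA'))).1
  simp only [eqToHom_refl, Category.comp_id, Iso.trans_hom, biprod.braiding_hom, Category.assoc,
    biprod.lift_fst] at hφ1 hφ3 hψ1 hψ3
  let TT : Bool → Triangle C := fun b => Bool.rec T₂ T₁ b
  let Φ : ∀ b, T ⟶ TT b := fun b => Bool.rec ψ φ b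
  have hTT : ∀ b, TT b ∈ distTriang C := fun b => by cases b <;> assumption
  have hprod := productTriangle_distinguished TT hTT
  let L := productTriangle.lift TT Φ
  have i1 : IsIso L.hom₁ := by
    have : L.hom₁ = a.hom ≫ (piBoolIso (fun b => (TT b).obj₁)).inv := by
      apply Pi.hom_ext
      intro b
      cases b
      · simpa [L, Φ, piBoolIso] using hψ1
      · simpa [L, Φ, piBoolIso] using hφ1
    rw [this]
    exact (a ≪≫ (piBoolIso (fun b => (TT b).obj₁)).symm).isIso_hom
  have i3 : IsIso L.hom₃ := by
    have : L.hom₃ = b.hom ≫ (piBoolIso (fun b => (TT b).obj₃)).inv := by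
      apply Pi.hom_ext
      intro b
      cases b
      · simpa [L, Φ, piBoolIso] using hψ3
      · simpa [L, Φ, piBoolIso] using hφ3
    rw [this]
    exact (b ≪≫ (piBoolIso (fun b => (TT b).obj₃)).symm).isIso_hom
  have i2 : IsIso L.hom₂ := isIso₂_of_isIso₁₃ L hT hprod i1 i3
  exact ⟨T₁.obj₂, hp _ hT₁ hA hB, T₂.obj₂, ha _ hT₂ hA' hB',
    ⟨asIso L.hom₂ ≪≫ piBoolIso (fun b => (TT b).obj₂)⟩⟩

end helpers

theorem statement_5
    [∀ X Y : C, FiniteDimensional k (X ⟶ Y)] [IsIdempotentComplete C]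
    (S : SerreFunctor k C) (d : ℕ) (hd : 1 ≤ d)
    (U : Set C) (hU : IsDCT d U) (hlb : LocallyBounded U) :
    ∃ Cp Ca : Set C,
      (∀ X : C, ∃ P ∈ Cp, ∃ A ∈ Ca, Nonempty (X ≅ P ⊞ A)) ∧
      (∀ P ∈ Cp, ∀ A ∈ Ca, (∀ f : P ⟶ A, f = 0) ∧ (∀ f : A ⟶ P, f = 0)) ∧
      (∀ P ∈ Cp, ∀ n : ℤ, P⟦n⟧ ∈ Cp) ∧ (∀ A ∈ Ca, ∀ n : ℤ, A⟦n⟧ ∈ Ca) ∧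
      (∀ X ∈ U ∩ Cp, NudPeriodic S d X) ∧
      (∀ X ∈ U ∩ Ca, Indecomp X → ¬ NudPeriodic S d X) := by
  -- indecomposable non-periodic objects of U
  let Ua : Set C := {A | A ∈ U ∧ Indecomp A ∧ ¬ NudPeriodic S d A}
  let Cp : Set C := {X | ∀ A ∈ Ua, ∀ n : ℤ, Orth X (A⟦n⟧)}
  let Ca : Set C := {Y | ∀ X ∈ Cp, Orth X Y}
  have isoU : ∀ X Y Z : C, (X ≅ Y ⊞ Z) → X ∈ U → Y ∈ U := by
    intro X Y Z e hX
    rw [← hU.add_closed]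
    exact ⟨X, Z, sums.of hX, ⟨e⟩⟩
  have orth_of_zero : ∀ X Y : C, IsZero X → Orth X Y := fun X Y h =>
    ⟨fun ⟨f, hf⟩ => hf (h.eq_of_src _ _), fun ⟨f, hf⟩ => hf (h.eq_of_tgt _ _)⟩
  have orth_symm : ∀ X Y : C, Orth X Y → Orth Y X := fun X Y h => ⟨h.2, h.1⟩
  have orth_shift : ∀ (X Y : C) (n : ℤ), Orth X (Y⟦-n⟧) → Orth (X⟦n⟧) Y := by
    intro X Y n h
    refine ⟨fun h' => h.1 ((nz_adj' _ _ _).1 h'), fun h' => h.2 ?_⟩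
    exact (nz_adj Y X n).1 h'
  have orth_iso : ∀ X Y Y' : C, (Y ≅ Y') → Orth X Y → Orth X Y' := fun X Y Y' e h =>
    ⟨fun h' => h.1 (h'.iso (Iso.refl _) e.symm), fun h' => h.2 (h'.iso e.symm (Iso.refl _))⟩
  have not_orth_self : ∀ X : C, ¬ IsZero X → ¬ Orth X X := fun X hX h =>
    hX ((IsZero.iff_id_eq_zero X).2 ((orth_zero h).1 _))
  have hCpShift : ∀ P ∈ Cp, ∀ n : ℤ, P⟦n⟧ ∈ Cp := by
    intro P hP n A hA m
    apply orth_shift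
    exact orth_iso _ _ _ ((shiftFunctorAdd' C m (-n) (m + -n) rfl).app A) (hP A hA (m + -n))
  have hCaShift : ∀ P ∈ Ca, ∀ n : ℤ, P⟦n⟧ ∈ Ca := by
    intro P hP n X hX
    exact orth_symm _ _ (orth_shift _ _ _ (orth_symm _ _ (hP _ (hCpShift X hX (-n)))))
  have hUa : ∀ A ∈ Ua, A ∈ Ca := by
    intro A hA X hX
    exact orth_iso _ _ _ ((shiftFunctorZero C ℤ).app A) (hX A hA 0)
  have hUp : ∀ A ∈ U, Indecomp A → NudPeriodic S d A → A ∈ Cp := by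
    intro A hA hAi hAp B hB n
    refine ⟨fun h => hB.2.2 (periodic_right S hU hlb hB.1 hB.2.1 hAp n h),
      fun h => hB.2.2 (periodic_left S hU hlb hB.1 hB.2.1 hAp (-n) ((nz_adj' _ _ _).1 h))⟩
  have hCpExt : ∀ T ∈ distTriang C, T.obj₁ ∈ Cp → T.obj₃ ∈ Cp → T.obj₂ ∈ Cp :=
    fun T hT h1 h3 A hA n => orth_ext hT _ (h1 A hA n) (h3 A hA n)
  have hCaExt : ∀ T ∈ distTriang C, T.obj₁ ∈ Ca → T.obj₃ ∈ Ca → T.obj₂ ∈ Ca :=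
    fun T hT h1 h3 X hX => orth_symm _ _
      (orth_ext hT _ (orth_symm _ _ (h1 X hX)) (orth_symm _ _ (h3 X hX)))
  have horth : ∀ P ∈ Cp, ∀ A ∈ Ca, Orth P A := fun P hP A hA => hA P hP
  have hCp0 : ∀ X, IsZero X → X ∈ Cp := fun X h A _ n => orth_of_zero _ _ h
  have hCa0 : ∀ X, IsZero X → X ∈ Ca := fun X h P _ => orth_symm _ _ (orth_of_zero _ _ h)
  obtain ⟨O, hO⟩ := HasZeroObject.zero (C := C)
  have decp : ∀ X ∈ Cp, Dec Cp Ca X := fun X h =>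
    ⟨X, h, O, hCa0 _ hO, ⟨isoBiprodZero hO⟩⟩
  have deca : ∀ X ∈ Ca, Dec Cp Ca X := fun X h =>
    ⟨O, hCp0 _ hO, X, h, ⟨isoZeroBiprod hO⟩⟩
  have ext := dec_ext Cp Ca horth (fun P h => hCpShift P h 1) (fun P h => hCaShift P h 1)
    hCpExt hCaExt
  have decIso : ∀ X Y : C, (X ≅ Y) → Dec Cp Ca Y → Dec Cp Ca X := by
    rintro X Y e ⟨P, hP, A, hA, ⟨f⟩⟩
    exact ⟨P, hP, A, hA, ⟨e ≪≫ f⟩⟩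
  have decU : ∀ X : C, X ∈ U → Dec Cp Ca X := by
    refine ks_ind k _ (fun X h _ => decp X (hCp0 X h)) ?_ ?_
    · intro X hX hXU
      by_cases hp : NudPeriodic S d X
      · exact decp X (hUp X hXU hX hp)
      · exact deca X (hUa X ⟨hXU, hX, hp⟩)
    · intro X Y Z e hY hZ hX
      exact decIso _ _ e (ext _ (binaryBiproductTriangle_distinguished Y Z)
        (hY (isoU X Y Z e hX)) (hZ (isoU X Z Y (e ≪≫ biprod.braiding _ _) hX)))
  have decShift : ∀ (X : C) (n : ℤ), Dec Cp Ca X → Dec Cp Ca (X⟦n⟧) := by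
    rintro X n ⟨P, hP, A, hA, ⟨f⟩⟩
    have := preservesBinaryBiproducts_of_preservesBiproducts (shiftFunctor C n)
    exact ⟨_, hCpShift P hP n, _, hCaShift A hA n,
      ⟨(shiftFunctor C n).mapIso f ≪≫ (shiftFunctor C n).mapBiprod _ _⟩⟩
  have decList : ∀ (l : List (Set C)), (∀ V ∈ l, ∀ X ∈ V, Dec Cp Ca X) →
      ∀ X ∈ starList C l, Dec Cp Ca X := by
    intro l
    induction l with
    | nil => intro _ X hX; exact decp X (hCp0 X hX)
    | cons V l ih =>
      intro h X hX
      cases l with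
      | nil => exact h V (by simp) X hX
      | cons W l =>
        obtain ⟨A, hA, B, hB, f, g, t, hT⟩ := hX
        exact ext _ hT (h V (by simp) A hA)
          (ih (fun V' hV' => h V' (List.mem_cons_of_mem _ hV')) B hB)
  refine ⟨Cp, Ca, ?_, fun P hP A hA => orth_zero (horth P hP A hA), hCpShift, hCaShift, ?_, ?_⟩
  · intro X
    refine decList _ ?_ X (hU.gen X)
    intro V hV Y hY
    obtain ⟨i, -, rfl⟩ := List.mem_map.1 hV
    obtain ⟨A, hA, ⟨e⟩⟩ := hY
    exact decIso _ _ e (decShift _ _ (decU A hA))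
  · have key : ∀ X : C, X ∈ U → X ∈ Cp → NudPeriodic S d X := by
      refine ks_ind k _ ?_ ?_ ?_
      · intro X hX _ _
        exact ⟨1, one_pos, ⟨((isZero_map_iff (nud S d) X).2 hX).iso hX⟩⟩
      · intro X hX hXU hXC
        by_contra hp
        exact not_orth_self X hX.1 (hUa X ⟨hXU, hX, hp⟩ X hXC)
      · intro X Y Z e hY hZ hXU hXC
        let e' := e ≪≫ biprod.braiding _ _
        obtain ⟨m, hm, hmY⟩ := hY (isoU X Y Z e hXU)
          (fun A hA n => orth_summand e (hXC A hA n))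
        obtain ⟨n, hn, hnZ⟩ := hZ (isoU X Z Y e' hXU)
          (fun A hA n => orth_summand e' (hXC A hA n))
        refine ⟨m * n, Nat.mul_pos hm hn, ?_⟩
        obtain ⟨eY⟩ := iter_mul _ _ _ hmY n
        obtain ⟨eZ⟩ := iter_mul _ _ _ hnZ m
        rw [Nat.mul_comm n m] at eZ
        obtain ⟨eB⟩ := iter_biprod (nud S d) Y Z (m * n)
        exact ⟨iterIso _ e _ ≪≫ eB ≪≫ biprod.mapIso eY eZ ≪≫ e.symm⟩
    exact fun X hX => key X hX.1 hX.2
  · intro X hX hXi hp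
    exact not_orth_self X hXi.1 (hX.2 X (hUp X hX.1 hXi hp))
end
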